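/- Let f : ℝ² → ℍ with ∫_{ℝ²} |f(s,t)| ds dt < ∞, and suppose its two-sided quaternion Fourier transform 𝓕_T satisfies ∫_{ℝ²} |𝓕_T(u,v)| du dv < ∞. Then f(s,t) = (1/(4π²)) ∫_{ℝ²} e^{i s u} 𝓕_T(u,v) e^{j t v} du dv for almost every (s,t) ∈ ℝ². -/

import Mathlib

open MeasureTheory Filter Real Set
open scoped Quaternion Topology

noncomputable section

def qi : ℍ[ℝ] := ⟨0,1,0,0⟩
def qj : ℍ[ℝ] := ⟨0,0,1,0⟩

/-- `e^{μθ} = cos θ + μ sin θ` for a (pure unit) quaternion `μ`. -/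
def qexp (μ : ℍ[ℝ]) (θ : ℝ) : ℍ[ℝ] := (Real.cos θ : ℍ[ℝ]) + Real.sin θ • μ

/-- Two-sided quaternion Fourier transform. -/
def QFT_T (f : ℝ × ℝ → ℍ[ℝ]) (u v : ℝ) : ℍ[ℝ] :=
  ∫ p : ℝ × ℝ, qexp qi (-(u * p.1)) * f p * qexp qj (-(v * p.2))


open scoped FourierTransform SchwartzMap ContDiff

theorem aux_V {V : Type*} [NormedAddCommGroup V] [InnerProductSpace ℝ V] [FiniteDimensional ℝ V]
    [MeasurableSpace V] [BorelSpace V] (f : V → ℂ) (hf : Integrable f) (hF : Integrable (𝓕 f)) :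
    ∀ᵐ x, f x = 𝓕⁻ (𝓕 f) x := by
  have hL : Continuous fun p : V × V => (innerₗ V) p.1 p.2 := continuous_inner
  have hL' : Continuous fun p : V × V => (-innerₗ V) p.1 p.2 := by
    exact hL.neg
  have hc : Continuous (𝓕⁻ (𝓕 f)) :=
    VectorFourier.fourierIntegral_continuous Real.continuous_fourierChar hL' hF
  refine ae_eq_of_integral_contDiff_smul_eq hf.locallyIntegrable hc.locallyIntegrable ?_
  intro g hg hgc
  have hg1 : HasCompactSupport (fun x => (g x : ℂ)) :=
    hgc.comp_left (g := fun r : ℝ => (r : ℂ)) (by simp)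
  have hg2 : ContDiff ℝ ∞ (fun x => (g x : ℂ)) := Complex.ofRealCLM.contDiff.comp hg
  set Ψ : 𝓢(V, ℂ) := hg1.toSchwartzMap hg2 with hΨ
  have e1 : ∀ x, Ψ x = (g x : ℂ) := fun x => rfl
  set Φ : 𝓢(V, ℂ) := 𝓕⁻ Ψ with hΦ
  have h1 : 𝓕 (⇑Φ) = ⇑Ψ := by
    rw [← SchwartzMap.fourier_coe, hΦ, FourierTransform.fourier_fourierInv_eq]
  have h2 : 𝓕⁻ (⇑Ψ) = ⇑Φ := by
    rw [← SchwartzMap.fourierInv_coe]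
  have A := VectorFourier.integral_fourierIntegral_smul_eq_flip (L := innerₗ V) (μ := volume)
    (ν := volume) Real.continuous_fourierChar hL Φ.integrable hf
  have B := VectorFourier.integral_fourierIntegral_smul_eq_flip (L := -innerₗ V) (μ := volume)
    (ν := volume) Real.continuous_fourierChar hL' Ψ.integrable hF
  have hfl : (innerₗ V).flip = innerₗ V := by ext; simp [real_inner_comm]
  have hfl' : (-innerₗ V).flip = -innerₗ V := by ext; simp [real_inner_comm]
  rw [hfl] at A
  rw [hfl'] at B
  calc ∫ x, g x • f x = ∫ x, (𝓕 (⇑Φ) x) • f x := by rw [h1]; simp [e1]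
    _ = ∫ x, Φ x • 𝓕 f x := A
    _ = ∫ x, (𝓕⁻ (⇑Ψ)) x • 𝓕 f x := by rw [h2]
    _ = ∫ x, Ψ x • 𝓕⁻ (𝓕 f) x := B
    _ = _ := by simp [e1]

theorem aux_pos (g : ℝ × ℝ → ℂ) (hg : Integrable g)
    (hG : Integrable (fun q : ℝ × ℝ =>
      ∫ p : ℝ × ℝ, Complex.exp (((-(q.1 * p.1) - q.2 * p.2 : ℝ) : ℂ) * Complex.I) * g p)) :
    ∀ᵐ p : ℝ × ℝ, g p = (1 / (4 * π ^ 2) : ℝ) • ∫ q : ℝ × ℝ,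
      Complex.exp (((p.1 * q.1 + p.2 * q.2 : ℝ) : ℂ) * Complex.I) *
      ∫ p : ℝ × ℝ, Complex.exp (((-(q.1 * p.1) - q.2 * p.2 : ℝ) : ℂ) * Complex.I) * g p := by
  set G : ℝ × ℝ → ℂ := fun q =>
      ∫ p : ℝ × ℝ, Complex.exp (((-(q.1 * p.1) - q.2 * p.2 : ℝ) : ℂ) * Complex.I) * g p with hGdef
  have mp := Complex.volume_preserving_equiv_real_prod
  have me := Complex.measurableEquivRealProd.measurableEmbedding
  set h : ℂ → ℂ := fun z => g (Complex.measurableEquivRealProd z) with hh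
  have hhi : Integrable h := (mp.integrable_comp_emb me).2 hg
  have key : ∀ w : ℂ, 𝓕 h w = G (Complex.measurableEquivRealProd ((2 * π) • w)) := by
    intro w
    rw [Real.fourier_eq', hGdef]
    simp only
    rw [← mp.integral_comp me]
    congr 1
    ext z
    rw [smul_eq_mul]
    congr 4
    simp [Complex.measurableEquivRealProd_apply, Complex.inner]
    ring
  have hpi : (2 * π) ≠ 0 := by positivity
  have hGc : Integrable (fun z => G (Complex.measurableEquivRealProd z)) :=
    (mp.integrable_comp_emb me).2 hG
  have hFi : Integrable (𝓕 h) := by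
    have := hGc.comp_smul hpi
    exact this.congr (Eventually.of_forall fun w => (key w).symm)
  have main := aux_V h hhi hFi
  have mps := mp.symm
  have main2 := mps.quasiMeasurePreserving.ae main
  filter_upwards [main2] with p hp
  have e0 : h (Complex.measurableEquivRealProd.symm p) = g p := by simp [hh]
  rw [e0] at hp
  rw [hp, Real.fourierInv_eq', ← mp.integral_comp me]
  set K : ℂ → ℂ := fun z => Complex.exp (((p.1 * z.re + p.2 * z.im : ℝ) : ℂ) * Complex.I) *
    G (Complex.measurableEquivRealProd z) with hK
  have h3 := Measure.integral_comp_smul volume K (2 * π)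
  calc _ = ∫ w, K ((2 * π) • w) := by
        congr 1
        ext w
        rw [key, smul_eq_mul, hK]
        simp only
        congr 4
        simp [Complex.measurableEquivRealProd_symm_apply, Complex.inner]
        ring
    _ = _ := by
        rw [h3]
        congr 1
        rw [Complex.finrank_real_complex, abs_of_nonneg (by positivity)]
        field_simp
        ring

theorem aux_neg (g : ℝ × ℝ → ℂ) (hg : Integrable g)
    (hG : Integrable (fun q : ℝ × ℝ =>
      ∫ p : ℝ × ℝ, Complex.exp (((-(q.1 * p.1) + q.2 * p.2 : ℝ) : ℂ) * Complex.I) * g p)) :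
    ∀ᵐ p : ℝ × ℝ, g p = (1 / (4 * π ^ 2) : ℝ) • ∫ q : ℝ × ℝ,
      Complex.exp (((p.1 * q.1 - p.2 * q.2 : ℝ) : ℂ) * Complex.I) *
      ∫ p : ℝ × ℝ, Complex.exp (((-(q.1 * p.1) + q.2 * p.2 : ℝ) : ℂ) * Complex.I) * g p := by
  let e : ℝ × ℝ ≃ᵐ ℝ × ℝ := (MeasurableEquiv.refl ℝ).prodCongr (MeasurableEquiv.neg ℝ)
  have he : ∀ p, e p = (p.1, -p.2) := fun p => rfl
  have mp : MeasurePreserving e volume volume :=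
    (MeasurePreserving.id volume).prod (Measure.measurePreserving_neg volume)
  have me := e.measurableEmbedding
  have hk : ∀ q : ℝ × ℝ, ∫ p : ℝ × ℝ, Complex.exp (((-(q.1 * p.1) + q.2 * p.2 : ℝ) : ℂ) * Complex.I) * g p
     = ∫ p : ℝ × ℝ, Complex.exp (((-(q.1 * p.1) - q.2 * p.2 : ℝ) : ℂ) * Complex.I) * g (e p) := by
    intro q
    rw [← mp.integral_comp me]
    simp [he, sub_eq_add_neg]
  simp only [hk] at hG ⊢
  have := aux_pos (fun p => g (e p)) ((mp.integrable_comp_emb me).2 hg) hG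
  filter_upwards [mp.quasiMeasurePreserving.ae this] with p hp
  have e2 : e (e p) = p := by simp [he]
  rw [e2] at hp
  rw [hp]
  simp [he, sub_eq_add_neg]

def Pp : ℍ[ℝ] →ₗ[ℝ] ℂ where
  toFun x := ⟨x.imJ - x.imI, x.imK + x.re⟩
  map_add' x y := by apply Complex.ext <;> simp <;> ring
  map_smul' r x := by apply Complex.ext <;> simp <;> ring

def Pm : ℍ[ℝ] →ₗ[ℝ] ℂ where
  toFun x := ⟨x.imJ + x.imI, x.imK - x.re⟩
  map_add' x y := by apply Complex.ext <;> simp <;> ring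
  map_smul' r x := by apply Complex.ext <;> simp <;> ring

theorem exp_form (θ : ℝ) : Complex.exp ((θ : ℂ) * Complex.I) = ⟨Real.cos θ, Real.sin θ⟩ := by
  apply Complex.ext <;> simp [Complex.exp_ofReal_mul_I_re, Complex.exp_ofReal_mul_I_im]

theorem qexp_qi (a : ℝ) : (qexp qi a).re = Real.cos a ∧ (qexp qi a).imI = Real.sin a ∧
    (qexp qi a).imJ = 0 ∧ (qexp qi a).imK = 0 := by
  have h1 : qi.re = 0 := rfl
  have h2 : qi.imI = 1 := rfl
  have h3 : qi.imJ = 0 := rfl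
  have h4 : qi.imK = 0 := rfl
  refine ⟨?_, ?_, ?_, ?_⟩ <;> simp [qexp, h1, h2, h3, h4]

theorem qexp_qj (a : ℝ) : (qexp qj a).re = Real.cos a ∧ (qexp qj a).imI = 0 ∧
    (qexp qj a).imJ = Real.sin a ∧ (qexp qj a).imK = 0 := by
  have h1 : qj.re = 0 := rfl
  have h2 : qj.imI = 0 := rfl
  have h3 : qj.imJ = 1 := rfl
  have h4 : qj.imK = 0 := rfl
  refine ⟨?_, ?_, ?_, ?_⟩ <;> simp [qexp, h1, h2, h3, h4]

theorem Pp_mul (a b : ℝ) (x : ℍ[ℝ]) :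
    Pp (qexp qi a * x * qexp qj b) = Complex.exp (((a - b : ℝ) : ℂ) * Complex.I) * Pp x := by
  rw [exp_form, Real.cos_sub, Real.sin_sub]
  obtain ⟨h1, h2, h3, h4⟩ := qexp_qi a
  obtain ⟨k1, k2, k3, k4⟩ := qexp_qj b
  apply Complex.ext <;> simp [Pp, h1, h2, h3, h4, k1, k2, k3, k4] <;> ring

theorem Pm_mul (a b : ℝ) (x : ℍ[ℝ]) :
    Pm (qexp qi a * x * qexp qj b) = Complex.exp (((a + b : ℝ) : ℂ) * Complex.I) * Pm x := by
  rw [exp_form, Real.cos_add, Real.sin_add]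
  obtain ⟨h1, h2, h3, h4⟩ := qexp_qi a
  obtain ⟨k1, k2, k3, k4⟩ := qexp_qj b
  apply Complex.ext <;> simp [Pm, h1, h2, h3, h4, k1, k2, k3, k4] <;> ring

theorem P_ext (x y : ℍ[ℝ]) (h1 : Pp x = Pp y) (h2 : Pm x = Pm y) : x = y := by
  have a := congrArg Complex.re h1
  have b := congrArg Complex.im h1
  have c := congrArg Complex.re h2
  have d := congrArg Complex.im h2
  simp only [Pp, Pm, LinearMap.coe_mk, AddHom.coe_mk] at a b c d
  ext <;> linarith

def PpL : ℍ[ℝ] →L[ℝ] ℂ := LinearMap.toContinuousLinearMap Pp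
def PmL : ℍ[ℝ] →L[ℝ] ℂ := LinearMap.toContinuousLinearMap Pm

theorem qexp_cont (μ : ℍ[ℝ]) : Continuous (qexp μ) := by
  unfold qexp
  exact (Quaternion.continuous_coe.comp Real.continuous_cos).add
    (Real.continuous_sin.smul continuous_const)

theorem qexp_bdd (μ : ℍ[ℝ]) (θ : ℝ) : ‖qexp μ θ‖ ≤ 1 + ‖μ‖ := by
  unfold qexp
  refine (norm_add_le _ _).trans ?_
  rw [Quaternion.norm_coe, norm_smul]
  have := Real.abs_cos_le_one θ
  have := Real.abs_sin_le_one θ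
  simp only [Real.norm_eq_abs]
  nlinarith [norm_nonneg μ]

theorem kernel_integrable (F : ℝ × ℝ → ℍ[ℝ]) (hF : Integrable F) (a b : ℝ × ℝ → ℝ)
    (ha : Continuous a) (hb : Continuous b) :
    Integrable (fun p => qexp qi (a p) * F p * qexp qj (b p)) := by
  have h1 : Integrable (fun p => qexp qi (a p) * F p) :=
    hF.bdd_mul (c := 1 + ‖qi‖) ((qexp_cont qi).comp ha).aestronglyMeasurable
      (Eventually.of_forall fun p => qexp_bdd _ _)
  exact h1.mul_bdd (c := 1 + ‖qj‖) ((qexp_cont qj).comp hb).aestronglyMeasurable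
      (Eventually.of_forall fun p => qexp_bdd _ _)

/-- Inversion theorem for the two-sided QFT of an integrable function with integrable QFT. -/
theorem qft_two_sided_inversion_L1
    (f : ℝ × ℝ → ℍ[ℝ]) (hf : Integrable f)
    (hF : Integrable (fun p : ℝ × ℝ => QFT_T f p.1 p.2)) :
    ∀ᵐ p : ℝ × ℝ, f p =
      (1 / (4 * π ^ 2)) • ∫ q : ℝ × ℝ, qexp qi (p.1 * q.1) * QFT_T f q.1 q.2 * qexp qj (p.2 * q.2) := by
  have hp1 : ∀ q : ℝ × ℝ, PpL (QFT_T f q.1 q.2) = ∫ p : ℝ × ℝ,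
      Complex.exp (((-(q.1 * p.1) + q.2 * p.2 : ℝ) : ℂ) * Complex.I) * PpL (f p) := by
    intro q
    rw [QFT_T, ← ContinuousLinearMap.integral_comp_comm PpL
      (kernel_integrable f hf _ _ (by fun_prop) (by fun_prop))]
    congr 1
    ext p
    refine (Pp_mul _ _ _).trans ?_
    rw [sub_neg_eq_add]
    rfl
  have hm1 : ∀ q : ℝ × ℝ, PmL (QFT_T f q.1 q.2) = ∫ p : ℝ × ℝ,
      Complex.exp (((-(q.1 * p.1) - q.2 * p.2 : ℝ) : ℂ) * Complex.I) * PmL (f p) := by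
    intro q
    rw [QFT_T, ← ContinuousLinearMap.integral_comp_comm PmL
      (kernel_integrable f hf _ _ (by fun_prop) (by fun_prop))]
    congr 1
    ext p
    refine (Pm_mul _ _ _).trans ?_
    rw [← sub_eq_add_neg]
    rfl
  have hpF := PpL.integrable_comp hF
  have hmF := PmL.integrable_comp hF
  simp only [hp1] at hpF
  simp only [hm1] at hmF
  have A := aux_neg _ (PpL.integrable_comp hf) hpF
  have B := aux_pos _ (PmL.integrable_comp hf) hmF
  filter_upwards [A, B] with p hA hB
  have hi : Integrable (fun q : ℝ × ℝ =>
      qexp qi (p.1 * q.1) * QFT_T f q.1 q.2 * qexp qj (p.2 * q.2)) :=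
    kernel_integrable _ hF _ _ (by fun_prop) (by fun_prop)
  apply P_ext
  · change PpL _ = PpL _
    rw [hA, map_smul, ← ContinuousLinearMap.integral_comp_comm PpL hi]
    congr 2
    ext q
    rw [← hp1]
    exact (Pp_mul _ _ _).symm
  · change PmL _ = PmL _
    rw [hB, map_smul, ← ContinuousLinearMap.integral_comp_comm PmL hi]
    congr 2
    ext q
    rw [← hm1]
    exact (Pm_mul _ _ _).symm
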